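/- arXiv:1809.04279 — 4 statements merged into one kernel-verified Lean document; each statement's English description precedes it below -/
import Mathlib

section
/- Let Φ ∈ ℝ^{n×b}, y ∈ ℝ^n, and let w̄_1,…,w̄_b ∈ ℝ^{m̄}. Let q_1,…,q_b ∈ ℝ^{m̄} each have entries summing to 1, and set q_c = ∏_{i=1}^b q_i(c_i) and s_j = Σ_{a=1}^{m̄} q_j(a) w̄_j(a). Then the expected squared residual over the full hypothesis grid satisfies Σ_{c ∈ {1,…,m̄}^b} q_c · ‖y − Φ w_c‖² = y^T y − 2 s^T (Φ^T y) + s^T Φ^T Φ s − Σ_{j=1}^b (Φ^TΦ)_{jj} s_j^2 + Σ_{j=1}^b (Φ^TΦ)_{jj} Σ_{a=1}^{m̄} q_j(a) w̄_j(a)^2, where w_c = (w̄_1(c_1),…,w̄_b(c_b)) ∈ ℝ^b. -/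
lemma mf_total (b m : ℕ) (q : Fin b → Fin m → ℝ) (hq : ∀ i, ∑ a, q i a = 1) :
    ∑ c : Fin b → Fin m, ∏ i, q i (c i) = 1 := by
  have h := Finset.prod_univ_sum (fun _ : Fin b => (Finset.univ : Finset (Fin m))) q
  rw [Fintype.piFinset_univ] at h
  rw [← h]; simp [hq]

lemma mf_one (b m : ℕ) (q : Fin b → Fin m → ℝ) (hq : ∀ i, ∑ a, q i a = 1)
    (j : Fin b) (f : Fin m → ℝ) :
    ∑ c : Fin b → Fin m, (∏ i, q i (c i)) * f (c j) = ∑ a, q j a * f a := by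
  have h := Finset.prod_univ_sum (fun _ : Fin b => (Finset.univ : Finset (Fin m)))
    (fun i a => q i a * (if i = j then f a else 1))
  rw [Fintype.piFinset_univ] at h
  simp only [Finset.prod_mul_distrib, Finset.prod_ite_eq', Finset.mem_univ, if_true] at h
  rw [← h, Finset.prod_eq_single j]
  · simp
  · intro i _ hi; simp [hi, hq]
  · simp

lemma mf_two (b m : ℕ) (q : Fin b → Fin m → ℝ) (hq : ∀ i, ∑ a, q i a = 1)
    (j k : Fin b) (hjk : j ≠ k) (f g : Fin m → ℝ) :
    ∑ c : Fin b → Fin m, (∏ i, q i (c i)) * (f (c j) * g (c k))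
      = (∑ a, q j a * f a) * ∑ a, q k a * g a := by
  have h := Finset.prod_univ_sum (fun _ : Fin b => (Finset.univ : Finset (Fin m)))
    (fun i a => q i a * ((if i = j then f a else 1) * (if i = k then g a else 1)))
  rw [Fintype.piFinset_univ] at h
  simp only [Finset.prod_mul_distrib, Finset.prod_ite_eq', Finset.mem_univ, if_true] at h
  rw [← h]
  have h2 : ∀ i, ∑ a, q i a * ((if i = j then f a else 1) * (if i = k then g a else 1))
      = (if i = j then ∑ a, q j a * f a else 1) * (if i = k then ∑ a, q k a * g a else 1) := by
    intro i
    by_cases h1 : i = j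
    · subst h1; simp [hjk]
    · by_cases h2 : i = k
      · subst h2; simp [h1]
      · simp [h1, h2, hq]
  simp only [h2, Finset.prod_mul_distrib, Finset.prod_ite_eq', Finset.mem_univ, if_true]

lemma mf_row (b m : ℕ) (w q : Fin b → Fin m → ℝ) (hq : ∀ i, ∑ a, q i a = 1)
    (s : Fin b → ℝ) (hs : ∀ j, s j = ∑ a, q j a * w j a) (p : Fin b → ℝ) (y : ℝ) :
    ∑ c : Fin b → Fin m, (∏ i, q i (c i)) * (y - ∑ j, p j * w j (c j)) ^ 2
      = y ^ 2 - 2 * (∑ j, s j * (p j * y)) + (∑ j, ∑ k, s j * (p j * p k) * s k)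
        - (∑ j, p j ^ 2 * s j ^ 2) + ∑ j, p j ^ 2 * ∑ a, q j a * w j a ^ 2 := by
  have e : ∀ c : Fin b → Fin m, (∏ i, q i (c i)) * (y - ∑ j, p j * w j (c j)) ^ 2
      = y ^ 2 * (∏ i, q i (c i)) - ∑ j, 2 * (p j * y) * ((∏ i, q i (c i)) * w j (c j))
        + ∑ j, ∑ k, p j * p k * ((∏ i, q i (c i)) * (w j (c j) * w k (c k))) := by
    intro c
    have e1 : ∑ j, 2 * (p j * y) * ((∏ i, q i (c i)) * w j (c j))
        = 2 * y * (∏ i, q i (c i)) * ∑ j, p j * w j (c j) := by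
      rw [Finset.mul_sum]; exact Finset.sum_congr rfl fun j _ => by ring
    have e2 : ∑ j, ∑ k, p j * p k * ((∏ i, q i (c i)) * (w j (c j) * w k (c k)))
        = (∏ i, q i (c i)) * ((∑ j, p j * w j (c j)) * ∑ j, p j * w j (c j)) := by
      rw [Finset.sum_mul_sum, Finset.mul_sum]
      refine Finset.sum_congr rfl fun j _ => ?_
      rw [Finset.mul_sum]; exact Finset.sum_congr rfl fun k _ => by ring
    rw [e1, e2]; ring
  have M : ∀ j k, ∑ c : Fin b → Fin m, (∏ i, q i (c i)) * (w j (c j) * w k (c k))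
      = s j * s k + if j = k then (∑ a, q j a * w j a ^ 2) - s j ^ 2 else 0 := by
    intro j k
    by_cases h : j = k
    · subst h
      have := mf_one b m q hq j (fun a => w j a * w j a)
      simp only [this, if_true, pow_two]; ring
    · rw [mf_two b m q hq j k h (w j) (w k), hs j, hs k]; simp [h]
  simp only [e, Finset.sum_add_distrib, Finset.sum_sub_distrib]
  rw [← Finset.mul_sum, mf_total b m q hq, Finset.sum_comm]
  have e3 : ∑ c : Fin b → Fin m, ∑ j, ∑ k,
      p j * p k * ((∏ i, q i (c i)) * (w j (c j) * w k (c k)))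
      = ∑ j, ∑ k, p j * p k *
        (s j * s k + if j = k then (∑ a, q j a * w j a ^ 2) - s j ^ 2 else 0) := by
    rw [Finset.sum_comm]
    refine Finset.sum_congr rfl fun j _ => ?_
    rw [Finset.sum_comm]
    refine Finset.sum_congr rfl fun k _ => ?_
    rw [← Finset.mul_sum, M]
  rw [e3]
  have e4 : ∀ j, ∑ c : Fin b → Fin m, 2 * (p j * y) * ((∏ i, q i (c i)) * w j (c j))
      = 2 * (s j * (p j * y)) := by
    intro j
    rw [← Finset.mul_sum, mf_one b m q hq j (w j), ← hs]; ring
  simp only [e4, mul_add, Finset.sum_add_distrib, mul_ite, mul_zero, Finset.sum_ite_eq,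
    Finset.mem_univ, if_true, mul_sub, Finset.sum_sub_distrib, ← Finset.mul_sum, pow_two]
  have e5 : ∑ j, ∑ k, p j * p k * (s j * s k) = ∑ j, ∑ k, s j * (p j * p k) * s k :=
    Finset.sum_congr rfl fun j _ => Finset.sum_congr rfl fun k _ => by ring
  rw [e5]; ring

/-- The expected squared residual over the full hypothesis grid under a
mean-field variational distribution:
`∑_c q_c ‖y − Φ w_c‖² = yᵀy − 2 sᵀ(Φᵀy) + sᵀΦᵀΦs − ∑ⱼ (ΦᵀΦ)ⱼⱼ sⱼ²
  + ∑ⱼ (ΦᵀΦ)ⱼⱼ ∑ₐ qⱼ(a) w̄ⱼ(a)²`. -/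
theorem direct_glm_expected_squared_residual (n b mbar : ℕ)
    (Φ : Fin n → Fin b → ℝ) (y : Fin n → ℝ)
    (w : Fin b → Fin mbar → ℝ) (q : Fin b → Fin mbar → ℝ)
    (hq : ∀ i, ∑ a, q i a = 1)
    (s : Fin b → ℝ) (hs : ∀ j, s j = ∑ a, q j a * w j a) :
    ∑ c : Fin b → Fin mbar, (∏ i, q i (c i)) *
        (∑ i : Fin n, (y i - ∑ j, Φ i j * w j (c j)) ^ 2)
      = (∑ i, (y i) ^ 2)
        - 2 * (∑ j, s j * (∑ i, Φ i j * y i))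
        + (∑ j, ∑ k, s j * (∑ i, Φ i j * Φ i k) * s k)
        - (∑ j, (∑ i, (Φ i j) ^ 2) * (s j) ^ 2)
        + ∑ j, (∑ i, (Φ i j) ^ 2) * (∑ a, q j a * (w j a) ^ 2) := by
  have e : ∀ c : Fin b → Fin mbar, (∏ i, q i (c i)) *
        (∑ i : Fin n, (y i - ∑ j, Φ i j * w j (c j)) ^ 2)
      = ∑ i : Fin n, (∏ i, q i (c i)) * (y i - ∑ j, Φ i j * w j (c j)) ^ 2 :=
    fun c => Finset.mul_sum _ _ _
  simp only [e]
  rw [Finset.sum_comm]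
  simp only [fun i => mf_row b mbar w q hq s hs (Φ i) (y i)]
  simp only [Finset.sum_add_distrib, Finset.sum_sub_distrib, ← Finset.mul_sum]
  have a1 : ∑ i, ∑ j, s j * (Φ i j * y i) = ∑ j, s j * ∑ i, Φ i j * y i := by
    rw [Finset.sum_comm]; simp only [Finset.mul_sum]
  have a2 : ∑ i, ∑ j, ∑ k, s j * (Φ i j * Φ i k) * s k
      = ∑ j, ∑ k, s j * (∑ i, Φ i j * Φ i k) * s k := by
    rw [Finset.sum_comm]
    refine Finset.sum_congr rfl fun j _ => ?_
    rw [Finset.sum_comm]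
    simp only [Finset.mul_sum, Finset.sum_mul]
  have a3 : ∀ v : Fin b → ℝ, ∑ i, ∑ j, Φ i j ^ 2 * v j = ∑ j, (∑ i, Φ i j ^ 2) * v j := by
    intro v
    rw [Finset.sum_comm]; simp only [Finset.sum_mul]
  rw [a1, a2, a3 (fun j => s j ^ 2), a3 (fun j => ∑ a, q j a * w j a ^ 2)]
end

section
/- Consider a generalized linear regression model y = Φw + ε with Φ ∈ ℝ^{n×b}, y ∈ ℝ^n, ε ∼ N(0, σ²I). Let w̄_1,…,w̄_b ∈ ℝ^{m̄} give the discrete support of the latent weights, let σ²_1,…,σ²_{m̄} > 0 give the discrete support of the noise variance, and let the factorized prior p_1,…,p_b, p_σ ∈ ℝ^{m̄} and factorized variational distribution q_1,…,q_b, q_σ ∈ ℝ^{m̄} all have strictly positive entries summing to 1. Define q_c = ∏_{i=1}^b q_i(c_i), s_j = Σ_{a=1}^{m̄} q_j(a) w̄_j(a), and the log-likelihood ℓ(k,c) = −(n/2) log σ²_k − ‖y − Φ w_c‖²/(2σ²_k) (dropping the additive constant −(n/2) log 2π), where w_c = (w̄_1(c_1),…,w̄_b(c_b)). Then the evidence lower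 bound ELBO = Σ_{k=1}^{m̄} Σ_{c ∈ {1,…,m̄}^b} q_σ(k) q_c [ ℓ(k,c) + Σ_{i=1}^b log p_i(c_i) + log p_σ(k) − Σ_{i=1}^b log q_i(c_i) − log q_σ(k) ] equals −(n/2) Σ_k q_σ(k) log σ²_k − (1/2)(Σ_k q_σ(k)/σ²_k) · ( y^T y − 2 s^T(Φ^T y) + s^T Φ^TΦ s − Σ_{j=1}^b (Φ^TΦ)_{jj} s_j² + Σ_{j=1}^b (Φ^TΦ)_{jj} Σ_{a=1}^{m̄} q_j(a) w̄_j(a)² ) + Σ_{i=1}^b ( Σ_a q_i(a) log p_i(a) − Σ_a q_i(a) log q_i(a) ) + Σ_k q_σ(k) log p_σ(k) − Σ_k q_σ(k) log q_σ(k). -/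
theorem dg_E0 {b m : ℕ} (g : Fin b → Fin m → ℝ) :
    ∑ c : Fin b → Fin m, ∏ i, g i (c i) = ∏ i, ∑ a, g i a := by
  rw [Finset.prod_univ_sum, Fintype.piFinset_univ]

theorem dg_E1 {b m : ℕ} (q : Fin b → Fin m → ℝ) (hq1 : ∀ i, ∑ a, q i a = 1)
    (j : Fin b) (f : Fin m → ℝ) :
    ∑ c : Fin b → Fin m, (∏ i, q i (c i)) * f (c j) = ∑ a, q j a * f a := by
  have h := dg_E0 (fun i a => q i a * (if i = j then f a else 1))
  simp only [Finset.prod_mul_distrib, Finset.prod_ite_eq', Finset.mem_univ, if_true] at h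
  rw [h, Finset.prod_eq_single j]
  · simp
  · intro i _ hij
    simp [hij, hq1]
  · simp

theorem dg_E2 {b m : ℕ} (q : Fin b → Fin m → ℝ) (hq1 : ∀ i, ∑ a, q i a = 1)
    (j k : Fin b) (hjk : j ≠ k) (f h : Fin m → ℝ) :
    ∑ c : Fin b → Fin m, (∏ i, q i (c i)) * (f (c j) * h (c k))
      = (∑ a, q j a * f a) * (∑ a, q k a * h a) := by
  have H := dg_E0 (fun i a => q i a * ((if i = j then f a else 1) * (if i = k then h a else 1)))
  simp only [Finset.prod_mul_distrib, Finset.prod_ite_eq', Finset.mem_univ, if_true] at H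
  rw [H, Finset.prod_eq_mul j k hjk]
  · simp [hjk, hjk.symm]
  · intro i _ hij
    simp [hij.1, hij.2, hq1]
  · simp
  · simp

theorem dg_sum1 {b m : ℕ} (q : Fin b → Fin m → ℝ) (hq1 : ∀ i, ∑ a, q i a = 1)
    (f : Fin b → Fin m → ℝ) :
    ∑ c : Fin b → Fin m, (∏ i, q i (c i)) * ∑ j, f j (c j) = ∑ j, ∑ a, q j a * f j a := by
  simp only [Finset.mul_sum]
  rw [Finset.sum_comm]
  exact Finset.sum_congr rfl fun j _ => dg_E1 q hq1 j (f j)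

theorem dg_sum2 {b m : ℕ} (q : Fin b → Fin m → ℝ) (hq1 : ∀ i, ∑ a, q i a = 1)
    (f : Fin b → Fin m → ℝ) :
    ∑ c : Fin b → Fin m, (∏ i, q i (c i)) * (∑ j, f j (c j)) ^ 2
      = (∑ j, ∑ a, q j a * f j a) ^ 2 - (∑ j, (∑ a, q j a * f j a) ^ 2)
        + ∑ j, ∑ a, q j a * (f j a) ^ 2 := by
  have key : ∀ j k, ∑ c : Fin b → Fin m, (∏ i, q i (c i)) * (f j (c j) * f k (c k))
      = (∑ a, q j a * f j a) * (∑ a, q k a * f k a)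
        + if j = k then (∑ a, q j a * (f j a) ^ 2) - (∑ a, q j a * f j a) ^ 2 else 0 := by
    intro j k
    by_cases hjk : j = k
    · subst hjk
      rw [dg_E1 q hq1 j (fun a => f j a * f j a)]
      simp only [if_true, ← sq]
      ring
    · rw [dg_E2 q hq1 j k hjk]
      simp [hjk]
  have : ∀ c : Fin b → Fin m, (∏ i, q i (c i)) * (∑ j, f j (c j)) ^ 2
      = ∑ j, ∑ k, (∏ i, q i (c i)) * (f j (c j) * f k (c k)) := by
    intro c
    rw [sq, Finset.sum_mul_sum, Finset.mul_sum]
    simp only [Finset.mul_sum]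
  simp only [this]
  rw [Finset.sum_comm]
  have h2 : ∀ j, ∑ c : Fin b → Fin m, ∑ k, (∏ i, q i (c i)) * (f j (c j) * f k (c k))
      = ∑ k, ((∑ a, q j a * f j a) * (∑ a, q k a * f k a)
        + if j = k then (∑ a, q j a * (f j a) ^ 2) - (∑ a, q j a * f j a) ^ 2 else 0) := by
    intro j
    rw [Finset.sum_comm]
    exact Finset.sum_congr rfl fun k _ => key j k
  simp only [h2, Finset.sum_add_distrib, Finset.sum_ite_eq, Finset.mem_univ, if_true,
    Finset.sum_sub_distrib]
  rw [sq, Finset.sum_mul_sum]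
  ring

theorem dg_quad {n b m : ℕ} (Φ : Fin n → Fin b → ℝ) (y : Fin n → ℝ)
    (w q : Fin b → Fin m → ℝ) (hq1 : ∀ i, ∑ a, q i a = 1)
    (s : Fin b → ℝ) (hs : ∀ j, s j = ∑ a, q j a * w j a) :
    ∑ c : Fin b → Fin m, (∏ i, q i (c i)) * (∑ i, (y i - ∑ j, Φ i j * w j (c j)) ^ 2)
      = (∑ i, (y i) ^ 2)
              - 2 * (∑ j, s j * (∑ i, Φ i j * y i))
              + (∑ j, ∑ k, s j * (∑ i, Φ i j * Φ i k) * s k)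
              - (∑ j, (∑ i, (Φ i j) ^ 2) * (s j) ^ 2)
              + ∑ j, (∑ i, (Φ i j) ^ 2) * (∑ a, q j a * (w j a) ^ 2) := by
  have hone : ∑ c : Fin b → Fin m, ∏ i, q i (c i) = 1 := by
    rw [dg_E0]; simp [hq1]
  have hlin : ∀ i j, ∑ a, q j a * (Φ i j * w j a) = Φ i j * s j := by
    intro i j
    rw [hs, Finset.mul_sum]
    exact Finset.sum_congr rfl fun a _ => by ring
  have hqd : ∀ i j, ∑ a, q j a * (Φ i j * w j a) ^ 2
      = Φ i j ^ 2 * ∑ a, q j a * (w j a) ^ 2 := by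
    intro i j
    rw [Finset.mul_sum]
    exact Finset.sum_congr rfl fun a _ => by ring
  have hi : ∀ i, ∑ c : Fin b → Fin m, (∏ i, q i (c i)) * (y i - ∑ j, Φ i j * w j (c j)) ^ 2
      = y i ^ 2 - 2 * y i * (∑ j, Φ i j * s j) + ((∑ j, Φ i j * s j) ^ 2
        - (∑ j, (Φ i j * s j) ^ 2) + ∑ j, Φ i j ^ 2 * ∑ a, q j a * (w j a) ^ 2) := by
    intro i
    have h1 := dg_sum1 q hq1 (fun j a => Φ i j * w j a)
    have h2 := dg_sum2 q hq1 (fun j a => Φ i j * w j a)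
    simp only [hlin, hqd] at h1 h2
    rw [← h2, ← h1]
    have : y i ^ 2 = ∑ c : Fin b → Fin m, (∏ i, q i (c i)) * y i ^ 2 := by
      rw [← Finset.sum_mul, hone, one_mul]
    rw [this, Finset.mul_sum, ← Finset.sum_sub_distrib, ← Finset.sum_add_distrib]
    exact Finset.sum_congr rfl fun c _ => by ring
  simp only [Finset.mul_sum (Finset.univ : Finset (Fin n))]
  rw [Finset.sum_comm]
  simp only [hi, Finset.sum_add_distrib, Finset.sum_sub_distrib]
  have e1 : ∑ i, 2 * y i * (∑ j, Φ i j * s j) = ∑ j, ∑ i, 2 * (s j * (Φ i j * y i)) := by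
    rw [Finset.sum_comm]
    refine Finset.sum_congr rfl fun i _ => ?_
    rw [Finset.mul_sum]
    exact Finset.sum_congr rfl fun j _ => by ring
  have e2 : ∑ i, (∑ j, Φ i j * s j) ^ 2 = ∑ j, ∑ k, s j * (∑ i, Φ i j * Φ i k) * s k := by
    simp only [sq, Finset.sum_mul_sum, Finset.mul_sum, Finset.sum_mul]
    rw [Finset.sum_comm]
    refine Finset.sum_congr rfl fun j _ => ?_
    rw [Finset.sum_comm]
    exact Finset.sum_congr rfl fun k _ => Finset.sum_congr rfl fun i _ => by ring
  have e3 : ∑ i, (∑ j, (Φ i j * s j) ^ 2) = ∑ j, (∑ i, (Φ i j) ^ 2) * (s j) ^ 2 := by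
    rw [Finset.sum_comm]
    simp only [Finset.sum_mul, mul_pow]
  have e4 : ∑ i, (∑ j, Φ i j ^ 2 * ∑ a, q j a * (w j a) ^ 2)
      = ∑ j, (∑ i, (Φ i j) ^ 2) * (∑ a, q j a * (w j a) ^ 2) := by
    rw [Finset.sum_comm]
    simp only [Finset.sum_mul]
  rw [e1, e2, e3, e4]
  simp only [← Finset.mul_sum]
  ring

/-- Theorem 1 (DIRECT): exact ELBO computation for a discretely relaxed
regression GLM with factorized prior and mean-field variational distribution
(including a discrete prior over the Gaussian noise variance). -/
theorem direct_glm_elbo (n b mbar : ℕ)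
    (Φ : Fin n → Fin b → ℝ) (y : Fin n → ℝ)
    (w : Fin b → Fin mbar → ℝ)
    (σ2 : Fin mbar → ℝ) (hσ2 : ∀ k, 0 < σ2 k)
    (p : Fin b → Fin mbar → ℝ) (pσ : Fin mbar → ℝ)
    (q : Fin b → Fin mbar → ℝ) (qσ : Fin mbar → ℝ)
    (hp : ∀ i a, 0 < p i a) (hpσ : ∀ k, 0 < pσ k)
    (hqpos : ∀ i a, 0 < q i a) (hqσpos : ∀ k, 0 < qσ k)
    (hp1 : ∀ i, ∑ a, p i a = 1) (hpσ1 : ∑ k, pσ k = 1)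
    (hq1 : ∀ i, ∑ a, q i a = 1) (hqσ1 : ∑ k, qσ k = 1)
    (s : Fin b → ℝ) (hs : ∀ j, s j = ∑ a, q j a * w j a)
    (ℓ : Fin mbar → (Fin b → Fin mbar) → ℝ)
    (hℓ : ∀ k c, ℓ k c = -((n : ℝ) / 2) * Real.log (σ2 k)
        - (∑ i : Fin n, (y i - ∑ j, Φ i j * w j (c j)) ^ 2) / (2 * σ2 k)) :
    ∑ k : Fin mbar, ∑ c : Fin b → Fin mbar,
        qσ k * (∏ i, q i (c i)) *
          (ℓ k c + (∑ i, Real.log (p i (c i))) + Real.log (pσ k)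
            - (∑ i, Real.log (q i (c i))) - Real.log (qσ k))
      = -((n : ℝ) / 2) * (∑ k, qσ k * Real.log (σ2 k))
        - (1 / 2) * (∑ k, qσ k / σ2 k) *
            ((∑ i, (y i) ^ 2)
              - 2 * (∑ j, s j * (∑ i, Φ i j * y i))
              + (∑ j, ∑ k, s j * (∑ i, Φ i j * Φ i k) * s k)
              - (∑ j, (∑ i, (Φ i j) ^ 2) * (s j) ^ 2)
              + ∑ j, (∑ i, (Φ i j) ^ 2) * (∑ a, q j a * (w j a) ^ 2))
        + (∑ i, ((∑ a, q i a * Real.log (p i a)) - ∑ a, q i a * Real.log (q i a)))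
        + (∑ k, qσ k * Real.log (pσ k))
        - ∑ k, qσ k * Real.log (qσ k) := by
  have hone : ∑ c : Fin b → Fin mbar, ∏ i, q i (c i) = 1 := by
    rw [dg_E0]; simp [hq1]
  rw [← dg_quad Φ y w q hq1 s hs]
  have hP := dg_sum1 q hq1 (fun j a => Real.log (p j a))
  have hQ := dg_sum1 q hq1 (fun j a => Real.log (q j a))
  rw [Finset.sum_sub_distrib, ← hP, ← hQ]
  set S := ∑ c : Fin b → Fin mbar,
    (∏ i, q i (c i)) * (∑ i, (y i - ∑ j, Φ i j * w j (c j)) ^ 2) with hS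
  set LP := ∑ c : Fin b → Fin mbar, (∏ i, q i (c i)) * ∑ j, Real.log (p j (c j)) with hLP
  set LQ := ∑ c : Fin b → Fin mbar, (∏ i, q i (c i)) * ∑ j, Real.log (q j (c j)) with hLQ
  have hk : ∀ k, ∑ c : Fin b → Fin mbar,
        qσ k * (∏ i, q i (c i)) *
          (ℓ k c + (∑ i, Real.log (p i (c i))) + Real.log (pσ k)
            - (∑ i, Real.log (q i (c i))) - Real.log (qσ k))
      = -((n : ℝ) / 2) * (qσ k * Real.log (σ2 k)) - (1 / 2) * (qσ k / σ2 k) * S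
        + qσ k * (LP - LQ) + qσ k * Real.log (pσ k) - qσ k * Real.log (qσ k) := by
    intro k
    have hne := (hσ2 k).ne'
    have : -((n : ℝ) / 2) * (qσ k * Real.log (σ2 k)) - (1 / 2) * (qσ k / σ2 k) * S
        + qσ k * (LP - LQ) + qσ k * Real.log (pσ k) - qσ k * Real.log (qσ k)
        = (-((n : ℝ) / 2) * (qσ k * Real.log (σ2 k)) + qσ k * Real.log (pσ k)
            - qσ k * Real.log (qσ k)) * (∑ c : Fin b → Fin mbar, ∏ i, q i (c i))
          - (1 / 2) * (qσ k / σ2 k) * S + qσ k * LP - qσ k * LQ := by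
      rw [hone]; ring
    rw [this, hS, hLP, hLQ]
    simp only [Finset.mul_sum (Finset.univ : Finset (Fin b → Fin mbar))]
    rw [← Finset.sum_sub_distrib, ← Finset.sum_add_distrib, ← Finset.sum_sub_distrib]
    refine Finset.sum_congr rfl fun c _ => ?_
    rw [hℓ]
    field_simp
    ring
  simp only [hk, Finset.sum_add_distrib, Finset.sum_sub_distrib, ← Finset.mul_sum,
    ← Finset.sum_mul, hqσ1]
  ring
end

section
/- Consider generalized linear logistic regression with Φ ∈ ℝ^{n×b}, classification labels y ∈ {0,1}^n, and class-conditional probability Pr(y_i = 0 | w) = (1 + exp(−Φ[i,:]w))^{−1}, with training examples sampled independently, so that the log-likelihood at hypothesis w_c is log ℓ_c = Σ_{i=1}^n ( −y_i z_{i,c} − log(1 + exp(−z_{i,c})) ) with z_{i,c} = Σ_{j=1}^b φ_{ij} w̄_j(c_j). Let q_1,…,q_b ∈ ℝ^{m̄} have nonnegative entries each summing to 1, q_c = ∏_{j=1}^b q_j(c_j), and s_j = Σ_{a=1}^{m̄} q_j(a) w̄_j(a). Then Σ_{c ∈ {1,…,m̄}^b} q_c log ℓ_c ≥ −s^T(Φ^T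 y) − Σ_{i=1}^n T_i, where T_i = ∏_{j=1}^b Σ_{a=1}^{m̄} q_j(a) exp(−φ_{ij} w̄_j(a)) if y_i = 0, and T_i = ∏_{j=1}^b Σ_{a=1}^{m̄} q_j(a) exp(φ_{ij} w̄_j(a)) − Σ_{j=1}^b φ_{ij} s_j if y_i = 1. -/
theorem mf_prod {b m : ℕ} (q f : Fin b → Fin m → ℝ) :
    ∑ c : Fin b → Fin m, (∏ j, q j (c j)) * ∏ j, f j (c j) = ∏ j, ∑ a, q j a * f j a := by
  rw [Fintype.prod_sum]
  simp only [Finset.prod_mul_distrib]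

theorem mf_coord {b m : ℕ} (q : Fin b → Fin m → ℝ) (hq1 : ∀ j, ∑ a, q j a = 1)
    (j : Fin b) (g : Fin m → ℝ) :
    ∑ c : Fin b → Fin m, (∏ k, q k (c k)) * g (c j) = ∑ a, q j a * g a := by
  have h := mf_prod q (fun k a => if k = j then g a else 1)
  have h1 : ∀ c : Fin b → Fin m, ∏ k, (if k = j then g (c k) else 1) = g (c j) := by
    intro c
    rw [Finset.prod_ite_eq' Finset.univ j (fun k => g (c k))]
    simp
  simp only [h1] at h
  rw [h, Finset.prod_eq_single j]
  · simp
  · intro k _ hk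
    simp [hk, hq1]
  · simp

theorem mf_lin {b m : ℕ} (q w : Fin b → Fin m → ℝ) (hq1 : ∀ j, ∑ a, q j a = 1)
    (φ : Fin b → ℝ) :
    ∑ c : Fin b → Fin m, (∏ k, q k (c k)) * (∑ j, φ j * w j (c j))
      = ∑ j, φ j * ∑ a, q j a * w j a := by
  simp only [Finset.mul_sum]
  rw [Finset.sum_comm]
  refine Finset.sum_congr rfl fun j _ => ?_
  rw [← Finset.mul_sum, ← mf_coord q hq1 j (w j), Finset.mul_sum]
  refine Finset.sum_congr rfl fun c _ => ?_
  ring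

theorem log_one_add_exp_le (z : ℝ) : Real.log (1 + Real.exp z) ≤ Real.exp z := by
  have := Real.log_le_sub_one_of_pos (show 0 < 1 + Real.exp z by positivity)
  linarith

theorem log_one_add_exp_neg_le (z : ℝ) :
    Real.log (1 + Real.exp (-z)) ≤ Real.exp z - z := by
  have h : 1 + Real.exp (-z) = Real.exp (-z) * (1 + Real.exp z) := by
    rw [mul_add, ← Real.exp_add]; simp [add_comm]
  rw [h, Real.log_mul (by positivity) (by positivity), Real.log_exp]
  linarith [log_one_add_exp_le z]

/-- Theorem 2 (DIRECT): ELBO lower bound for generalized linear logistic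
regression. The expected log-likelihood term satisfies
`qᵀ log ℓ ≥ −sᵀ(Φᵀy) − ∑ᵢ Tᵢ` with `Tᵢ` given by the Taylor-truncation
bound chosen according to the label `yᵢ ∈ {0,1}`. -/
theorem direct_logistic_elbo_lower_bound (n b mbar : ℕ)
    (Φ : Fin n → Fin b → ℝ) (y : Fin n → ℝ)
    (hy : ∀ i, y i = 0 ∨ y i = 1)
    (w : Fin b → Fin mbar → ℝ) (q : Fin b → Fin mbar → ℝ)
    (hq0 : ∀ j a, 0 ≤ q j a) (hq1 : ∀ j, ∑ a, q j a = 1)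
    (s : Fin b → ℝ) (hs : ∀ j, s j = ∑ a, q j a * w j a) :
    ∑ c : Fin b → Fin mbar, (∏ j, q j (c j)) *
        (∑ i, (-(y i) * (∑ j, Φ i j * w j (c j))
          - Real.log (1 + Real.exp (-(∑ j, Φ i j * w j (c j))))))
      ≥ -(∑ j, s j * (∑ i, Φ i j * y i))
        - ∑ i, (if y i = 0 then
              ∏ j, ∑ a, q j a * Real.exp (-(Φ i j) * w j a)
            else
              (∏ j, ∑ a, q j a * Real.exp (Φ i j * w j a))
                - ∑ j, Φ i j * s j) := by
  have hR : -(∑ j, s j * (∑ i, Φ i j * y i)) = ∑ i, -(y i) * ∑ j, Φ i j * s j := by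
    simp only [Finset.mul_sum]
    rw [Finset.sum_comm, ← Finset.sum_neg_distrib]
    refine Finset.sum_congr rfl fun i _ => ?_
    rw [← Finset.sum_neg_distrib]
    refine Finset.sum_congr rfl fun j _ => ?_
    ring
  rw [hR, ← Finset.sum_sub_distrib]
  simp only [Finset.mul_sum (s := (Finset.univ : Finset (Fin n)))]
  rw [Finset.sum_comm]
  refine Finset.sum_le_sum fun i _ => ?_
  have hQ : ∀ c : Fin b → Fin mbar, 0 ≤ ∏ j, q j (c j) :=
    fun c => Finset.prod_nonneg fun j _ => hq0 j _
  have hl := mf_lin q w hq1 (Φ i)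
  simp only [← hs] at hl
  rcases hy i with h | h
  · rw [if_pos h, h, ← mf_prod q (fun j a => Real.exp (-(Φ i j) * w j a))]
    simp only [neg_zero, zero_mul, zero_sub]
    rw [← Finset.sum_neg_distrib]
    refine Finset.sum_le_sum fun c _ => ?_
    rw [← Real.exp_sum]
    simp only [neg_mul, Finset.sum_neg_distrib]
    have := mul_le_mul_of_nonneg_left
      (log_one_add_exp_le (-(∑ j, Φ i j * w j (c j)))) (hQ c)
    linarith
  · rw [if_neg (by rw [h]; exact one_ne_zero), h,
      ← mf_prod q (fun j a => Real.exp (Φ i j * w j a)), ← hl]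
    have e : ∀ A B : ℝ, -1 * B - (A - B) = -A := by intros; ring
    rw [e, ← Finset.sum_neg_distrib]
    refine Finset.sum_le_sum fun c _ => ?_
    rw [← Real.exp_sum]
    have := mul_le_mul_of_nonneg_left
      (log_one_add_exp_neg_le (∑ j, Φ i j * w j (c j))) (hQ c)
    linarith
end

section
/- Let r, b, m̄ be positive integers, let α_1,…,α_r ≥ 0 with Σ_{j=1}^r α_j = 1, and for each j ∈ {1,…,r}, i ∈ {1,…,b} let q_i^{(j)} ∈ ℝ^{m̄} have nonnegative entries summing to 1, defining the mixture variational distribution q_c = Σ_{j=1}^r α_j ∏_{i=1}^b q_i^{(j)}(c_i) over c ∈ {1,…,m̄}^b. Then for every choice of vectors a_1,…,a_b ∈ (0,1)^{m̄}, the entropy satisfies −Σ_c q_c log q_c ≥ 1 − Σ_{j=1}^r α_j ( Σ_{i=1}^b Σ_{a=1}^{m̄} q_i^{(j)}(a) log a_i(a) + α_j ∏_{i=1}^b Σ_{a=1}^{m̄} q_i^{(j)}(a)²/a_i(a) + 2 Σ_{k=j+1}^r α_k ∏_{i=1}^b Σ_{a=1}^{m̄} q_i^{(j)}(a) q_i^{(k)}(a)/a_i(a)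 ); consequently −Σ_c q_c log q_c is bounded below by the maximum of this expression over all such a_1,…,a_b. (Here 0·log 0 is interpreted as 0.) -/
theorem aux_prod_sum {b m : ℕ} (f : Fin b → Fin m → ℝ) :
    ∑ c : Fin b → Fin m, ∏ i, f i (c i) = ∏ i, ∑ a, f i a := by
  rw [Finset.prod_univ_sum, Fintype.piFinset_univ]

theorem aux_marginal {b m : ℕ} (q : Fin b → Fin m → ℝ) (hq : ∀ i, ∑ a, q i a = 1)
    (g : Fin b → Fin m → ℝ) :
    ∑ c : Fin b → Fin m, (∏ i, q i (c i)) * ∑ i, g i (c i) = ∑ i, ∑ a, q i a * g i a := by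
  simp_rw [Finset.mul_sum]
  rw [Finset.sum_comm]
  refine Finset.sum_congr rfl fun i _ => ?_
  have h1 : ∀ c : Fin b → Fin m, (∏ i', q i' (c i')) * g i (c i)
      = ∏ i', (q i' (c i') * if i' = i then g i' (c i') else 1) := by
    intro c
    rw [Finset.prod_mul_distrib]
    simp
  simp_rw [h1]
  rw [aux_prod_sum (fun i' a => q i' a * if i' = i then g i' a else 1)]
  rw [Finset.prod_eq_single i]
  · simp
  · intro k _ hk
    simp [hk, hq]
  · simp

theorem aux_sym {r : ℕ} (M : Fin r → Fin r → ℝ) (hM : ∀ j k, M j k = M k j) :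
    ∑ j, ∑ k, M j k = ∑ j, (M j j + 2 * ∑ k ∈ Finset.Ioi j, M j k) := by
  have h1 : ∀ j : Fin r, ∑ k, M j k
      = M j j + ∑ k ∈ Finset.Ioi j, M j k + ∑ k ∈ Finset.Iio j, M j k := by
    intro j
    have e : (Finset.univ : Finset (Fin r)) = insert j (Finset.Ioi j ∪ Finset.Iio j) := by
      ext k
      simp only [Finset.mem_univ, Finset.mem_insert, Finset.mem_union, Finset.mem_Ioi,
        Finset.mem_Iio, true_iff]
      rcases lt_trichotomy k j with h | h | h <;> simp [h]
    rw [e, Finset.sum_insert (by simp), Finset.sum_union, add_assoc]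
    rw [Finset.disjoint_left]
    intro k hk hk'
    simp only [Finset.mem_Ioi, Finset.mem_Iio] at hk hk'
    exact lt_asymm hk hk'
  have h2 : ∑ j, ∑ k ∈ Finset.Iio j, M j k = ∑ j, ∑ k ∈ Finset.Ioi j, M j k := by
    rw [Finset.sum_comm' (t' := Finset.univ) (s' := fun k => Finset.Ioi k) (by simp)]
    exact Finset.sum_congr rfl fun j _ => Finset.sum_congr rfl fun k _ => hM _ _
  simp_rw [h1]
  simp only [Finset.sum_add_distrib, ← Finset.mul_sum]
  rw [h2]
  ring

theorem aux_log (q a : ℝ) (hq : 0 ≤ q) (ha : 0 < a) :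
    q * Real.log q ≤ q * Real.log a + q ^ 2 / a - q := by
  rcases hq.eq_or_lt with h | h
  · simp [← h]
  · have h1 := Real.log_le_sub_one_of_pos (div_pos h ha)
    rw [Real.log_div h.ne' ha.ne'] at h1
    have h2 := mul_le_mul_of_nonneg_left h1 hq
    have h3 : q ^ 2 / a = q * (q / a) := by ring
    rw [h3]
    linarith

/-- Theorem 3 (DIRECT): entropy lower bound for a finite mixture of factorized
categorical variational distributions. For every choice of Taylor-expansion
centers `A i ∈ (0,1)^m̄`, the entropy of the mixture `q_c = ∑ⱼ αⱼ ∏ᵢ Qⱼᵢ(cᵢ)`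
is bounded below by the stated expression (hence also by its maximum over all
such centers). (In Lean, `Real.log 0 = 0`, so `x * Real.log x` implements the
convention `0 · log 0 = 0`.) -/
theorem mixture_entropy_lower_bound (r b mbar : ℕ)
    (hr : 0 < r) (hb : 0 < b) (hm : 0 < mbar)
    (α : Fin r → ℝ) (hα0 : ∀ j, 0 ≤ α j) (hα1 : ∑ j, α j = 1)
    (Q : Fin r → Fin b → Fin mbar → ℝ)
    (hQ0 : ∀ j i a, 0 ≤ Q j i a) (hQ1 : ∀ j i, ∑ a, Q j i a = 1)
    (A : Fin b → Fin mbar → ℝ) (hA : ∀ i a, A i a ∈ Set.Ioo (0 : ℝ) 1) :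
    -(∑ c : Fin b → Fin mbar,
        (∑ j, α j * ∏ i, Q j i (c i)) *
          Real.log (∑ j, α j * ∏ i, Q j i (c i)))
      ≥ 1 - ∑ j, α j *
          ((∑ i, ∑ a, Q j i a * Real.log (A i a))
            + α j * (∏ i, ∑ a, (Q j i a) ^ 2 / A i a)
            + 2 * ∑ k ∈ Finset.Ioi j,
                α k * ∏ i, ∑ a, Q j i a * Q k i a / A i a) := by
  have hpos : ∀ i a, 0 < A i a := fun i a => (hA i a).1
  have hS1 : ∑ c : Fin b → Fin mbar, (∑ j, α j * ∏ i, Q j i (c i)) = 1 := by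
    rw [Finset.sum_comm]
    simp_rw [← Finset.mul_sum, aux_prod_sum, hQ1]
    simpa using hα1
  have hS2 : ∑ c : Fin b → Fin mbar,
      (∑ j, α j * ∏ i, Q j i (c i)) * Real.log (∏ i, A i (c i))
      = ∑ j, α j * ∑ i, ∑ a, Q j i a * Real.log (A i a) := by
    simp_rw [Finset.sum_mul]
    rw [Finset.sum_comm]
    refine Finset.sum_congr rfl fun j _ => ?_
    rw [← aux_marginal (Q j) (hQ1 j) (fun i a => Real.log (A i a)), Finset.mul_sum]
    refine Finset.sum_congr rfl fun c _ => ?_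
    rw [Real.log_prod (fun i _ => (hpos i (c i)).ne'), mul_assoc]
  have hS3 : ∑ c : Fin b → Fin mbar,
      (∑ j, α j * ∏ i, Q j i (c i)) ^ 2 / (∏ i, A i (c i))
      = ∑ j, ∑ k, α j * α k * ∏ i, ∑ a, Q j i a * Q k i a / A i a := by
    simp_rw [← aux_prod_sum, Finset.mul_sum]
    have : ∀ c : Fin b → Fin mbar, (∑ j, α j * ∏ i, Q j i (c i)) ^ 2 / (∏ i, A i (c i))
        = ∑ j, ∑ k, α j * α k * ∏ i, (Q j i (c i) * Q k i (c i) / A i (c i)) := by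
      intro c
      rw [sq, Finset.sum_mul_sum, Finset.sum_div]
      refine Finset.sum_congr rfl fun j _ => ?_
      rw [Finset.sum_div]
      refine Finset.sum_congr rfl fun k _ => ?_
      rw [Finset.prod_div_distrib, Finset.prod_mul_distrib]
      ring
    simp_rw [this]
    rw [Finset.sum_comm]
    refine Finset.sum_congr rfl fun j _ => ?_
    rw [Finset.sum_comm]
  rw [aux_sym _ (fun j k => by
    rw [mul_comm (α j)]
    congr 1
    exact Finset.prod_congr rfl fun i _ => Finset.sum_congr rfl fun a _ => by
      rw [mul_comm (Q j i a)])] at hS3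
  have hmain := Finset.sum_le_sum (s := Finset.univ) fun (c : Fin b → Fin mbar) _ =>
    aux_log (∑ j, α j * ∏ i, Q j i (c i)) (∏ i, A i (c i))
      (Finset.sum_nonneg fun j _ => mul_nonneg (hα0 j)
        (Finset.prod_nonneg fun i _ => hQ0 j i (c i)))
      (Finset.prod_pos fun i _ => hpos i (c i))
  rw [Finset.sum_sub_distrib, Finset.sum_add_distrib, hS1, hS2, hS3,
    ← Finset.sum_add_distrib] at hmain
  have e : ∑ j, α j *
          ((∑ i, ∑ a, Q j i a * Real.log (A i a))
            + α j * (∏ i, ∑ a, (Q j i a) ^ 2 / A i a)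
            + 2 * ∑ k ∈ Finset.Ioi j,
                α k * ∏ i, ∑ a, Q j i a * Q k i a / A i a)
      = ∑ j, (α j * (∑ i, ∑ a, Q j i a * Real.log (A i a)) +
        (α j * α j * (∏ i, ∑ a, Q j i a * Q j i a / A i a) + 2 * ∑ k ∈ Finset.Ioi j,
          α j * α k * ∏ i, ∑ a, Q j i a * Q k i a / A i a)) := by
    refine Finset.sum_congr rfl fun j _ => ?_
    simp_rw [mul_assoc (α j), ← Finset.mul_sum, sq]
    ring
  rw [e]
  linarith
end
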